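/- For all n ≥ 2, there is no 1-resilient lock-free strongly linearizable implementation of a single-writer single-reader (SWSR) register in an asynchronous message-passing system of n processes. -/

import Mathlib

/-!
A model of asynchronous message-passing systems with `n` processes, following
Fischer–Lynch–Paterson: in a step `(p, m)` process `p` receives message `m`
(`none` if no message), changes its local state, and sends a finite set of messages.
Object implementations encode invocations and responses of operations as changes
of the state of the invoking process.
-/

namespace MP

/-- A step `(p, m)`: process `p` takes a step in which it attempts to receive a
message; it receives `m`, where `m = none` means it receives no message. -/
abbrev Step (n : ℕ) (Msg : Type) : Type := Fin n × Option Msg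

/-- An operation event: the invocation of an operation `o`, or the response of `o`
with return value `v`. -/
inductive Event (Op Val : Type) : Type
  | inv (o : Op)
  | res (o : Op) (v : Val)
deriving DecidableEq

/-- The operation an event belongs to. -/
def Event.opOf {Op Val : Type} : Event Op Val → Op
  | .inv o => o
  | .res o _ => o

/-- A (deterministic) message-passing implementation for `n` processes, of an object
with operations `Op` returning values in `Val`.  In each step a process receives at
most one message, changes its local state via `trans`, and sends a finite list of
messages; invocations and responses of operations are encoded (via `eventOf`) as
changes of the state of the invoking process.  `procOf o` is the process that may
invoke operation `o`. -/
structure Impl (n : ℕ) (Op Val : Type) : Type 1 where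
  Msg : Type
  PState : Type
  init : Fin n → PState
  trans : Fin n → PState → Option Msg → PState × List (Fin n × Msg)
  eventOf : Fin n → PState → PState → Option (Event Op Val)
  procOf : Op → Fin n

variable {n : ℕ} {Op Val : Type}

/-- A configuration: the local states of all processes together with the message
buffer (the multiset of all messages sent but not yet received, tagged with their
destination process). -/
structure Config (I : Impl n Op Val) : Type where
  states : Fin n → I.PState
  buffer : Multiset (Fin n × I.Msg)

/-- The initial configuration: all processes in their initial states, empty buffer. -/
def initConfig (I : Impl n Op Val) : Config I :=
  ⟨I.init, 0⟩

/-- A step `(p, some m)` is applicable to `C` iff `m` is in the buffer for `p`;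
a step `(p, none)` is always applicable. -/
def Applicable (I : Impl n Op Val) (C : Config I) (e : Step n I.Msg) : Prop :=
  match e.2 with
  | none => True
  | some m => (e.1, m) ∈ C.buffer

open scoped Classical in
/-- The configuration resulting from applying step `e` to configuration `C`:
the stepping process changes state, the received message (if any) is removed from
the buffer, and the sent messages are added to it. -/
noncomputable def applyStep (I : Impl n Op Val) (C : Config I) (e : Step n I.Msg) :
    Config I :=
  { states := Function.update C.states e.1 (I.trans e.1 (C.states e.1) e.2).1
    buffer :=
      (match e.2 with
        | none => C.buffer
        | some m => C.buffer.erase (e.1, m))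
      + ((I.trans e.1 (C.states e.1) e.2).2 : Multiset (Fin n × I.Msg)) }

/-- A finite history (sequence of steps) `H` is applicable to `C` if each of its
steps is applicable in turn. -/
def ApplicableHist (I : Impl n Op Val) : Config I → List (Step n I.Msg) → Prop
  | _, [] => True
  | C, e :: H => Applicable I C e ∧ ApplicableHist I (applyStep I C e) H

/-- `H(C)`: the configuration obtained by applying the finite history `H` to `C`. -/
noncomputable def applyHist (I : Impl n Op Val) : Config I → List (Step n I.Msg) → Config I
  | C, [] => C
  | C, e :: H => applyHist I (applyStep I C e) H

/-- The event (if any) encoded by the state change of the process taking step `e`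
from configuration `C`. -/
noncomputable def stepEvent (I : Impl n Op Val) (C : Config I) (e : Step n I.Msg) :
    Option (Event Op Val) :=
  I.eventOf e.1 (C.states e.1) ((applyStep I C e).states e.1)

/-- The operation-level history (sequence of invocation/response events) of the run
in which `H` is applied to `C`. -/
noncomputable def runEvents (I : Impl n Op Val) :
    Config I → List (Step n I.Msg) → List (Event Op Val)
  | _, [] => []
  | C, e :: H => (stepEvent I C e).toList ++ runEvents I (applyStep I C e) H

/-- The set of (finite) histories of implementation `I`: all finite histories
applicable to the initial configuration.  (This set is prefix-closed.) -/
def Histories (I : Impl n Op Val) : Set (List (Step n I.Msg)) :=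
  {H | ApplicableHist I (initConfig I) H}

/-- The operation-level events of a history `H` of `I`. -/
noncomputable def events (I : Impl n Op Val) (H : List (Step n I.Msg)) :
    List (Event Op Val) :=
  runEvents I (initConfig I) H

/-- Operation `o` has been invoked in the event history `L`. -/
def Invoked (o : Op) (L : List (Event Op Val)) : Prop := Event.inv o ∈ L

/-- Operation `o` is complete in the event history `L`: `L` contains both its
invocation and a response for it. -/
def Completed (o : Op) (L : List (Event Op Val)) : Prop :=
  Event.inv o ∈ L ∧ ∃ v, Event.res o v ∈ L

/-- Operation `o` is pending in `L`: invoked but with no response. -/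
def Pending (o : Op) (L : List (Event Op Val)) : Prop :=
  Event.inv o ∈ L ∧ ∀ v, Event.res o v ∉ L

/-- `o` precedes `o'` in `L`: a response of `o` occurs (strictly) before the
invocation of `o'`. -/
def Precedes (L : List (Event Op Val)) (o o' : Op) : Prop :=
  ∃ (i j : ℕ) (hi : i < L.length) (hj : j < L.length),
    i < j ∧ (∃ v, L.get ⟨i, hi⟩ = Event.res o v) ∧ L.get ⟨j, hj⟩ = Event.inv o'

/-- A sequential event history: invocations immediately followed by their matching
responses, possibly ending with a single pending invocation (no two operations are
concurrent). -/
def Sequential : List (Event Op Val) → Prop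
  | [] => True
  | [Event.inv _] => True
  | Event.inv o :: Event.res o' _ :: L => o = o' ∧ Sequential L
  | _ => False

/-- `x` occurs at most once in the list `L`. -/
def AtMostOnce {β : Type _} (x : β) (L : List β) : Prop :=
  ∀ (i j : ℕ) (hi : i < L.length) (hj : j < L.length),
    L.get ⟨i, hi⟩ = x → L.get ⟨j, hj⟩ = x → i = j

/-- Operation `o` has at most one response event in `L`. -/
def AtMostOneRes (o : Op) (L : List (Event Op Val)) : Prop :=
  ∀ (i j : ℕ) (hi : i < L.length) (hj : j < L.length) (v v' : Val),
    L.get ⟨i, hi⟩ = Event.res o v → L.get ⟨j, hj⟩ = Event.res o v' → i = j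

/-- Well-formedness of an implementation: in every history, each operation is
invoked at most once, responds at most once, and responses follow invocations. -/
def WellFormed (I : Impl n Op Val) : Prop :=
  ∀ H ∈ Histories I,
    (∀ o : Op, AtMostOnce (Event.inv o) (events I H)) ∧
    (∀ o : Op, AtMostOneRes o (events I H)) ∧
    (∀ (o : Op) (v : Val), Event.res o v ∈ events I H → Event.inv o ∈ events I H)

/-- `L'` is a completion of the event history `L`: the events of a subset (`removed`)
of the pending operations of `L` are removed, and the remaining pending operations
are completed by appending responses `R` for them. -/
def IsCompletion (L L' : List (Event Op Val)) : Prop :=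
  ∃ (removed : Op → Bool) (R : List (Event Op Val)),
    (∀ o, removed o = true → Pending o L) ∧
    (∀ ev ∈ R, ∃ (o : Op) (v : Val), ev = Event.res o v ∧ Pending o L ∧ removed o = false) ∧
    (∀ o : Op, Pending o L → removed o = false → ∃ v, Event.res o v ∈ R) ∧
    (R.map Event.opOf).Nodup ∧
    L' = L.filter (fun ev => !removed ev.opOf) ++ R

/-- `f` is a linearization function for (the set of histories of) `I` with respect to
the sequential specification `Spec`: it maps each history `H` of `I` to a sequential
history `f H` that (1) has exactly the same operations (with the same responses) as
some completion of the events of `H`, (2) respects precedence, and (3) conforms to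
`Spec`. -/
def IsLinearizationFn (I : Impl n Op Val) (Spec : List (Event Op Val) → Prop)
    (f : List (Step n I.Msg) → List (Event Op Val)) : Prop :=
  ∀ H ∈ Histories I,
    Sequential (f H) ∧
    (∃ L', IsCompletion (events I H) L' ∧
      (∀ ev : Event Op Val, ev ∈ f H ↔ ev ∈ L') ∧
      (∀ o o' : Op, Precedes L' o o' → Precedes (f H) o o')) ∧
    Spec (f H)

/-- `I` is linearizable with respect to the sequential specification `Spec`. -/
def Linearizable (I : Impl n Op Val) (Spec : List (Event Op Val) → Prop) : Prop :=
  ∃ f, IsLinearizationFn I Spec f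

/-- `I` is strongly linearizable: there is a linearization function mapping
prefixes of histories to prefixes of their linearizations. -/
def StronglyLinearizable (I : Impl n Op Val) (Spec : List (Event Op Val) → Prop) : Prop :=
  ∃ f, IsLinearizationFn I Spec f ∧
    ∀ G H, G ∈ Histories I → H ∈ Histories I → G <+: H → f G <+: f H

/-- The finite history consisting of the first `k` steps of an infinite history `S`. -/
def prefixSteps {β : Type _} (S : ℕ → β) (k : ℕ) : List β :=
  (List.range k).map S

/-- The infinite history `S` is applicable to `C`: every step is applicable to the
configuration reached by the preceding steps. -/
def InfApplicable (I : Impl n Op Val) (C : Config I) (S : ℕ → Step n I.Msg) : Prop :=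
  ∀ k, Applicable I (applyHist I C (prefixSteps S k)) (S k)

/-- Process `p` is correct in the infinite history `S`: it takes infinitely many steps. -/
def CorrectProc {Msg : Type} (p : Fin n) (S : ℕ → Step n Msg) : Prop :=
  ∀ k, ∃ k' ≥ k, (S k').1 = p

/-- At most one process crashes (i.e., takes only finitely many steps) in `S`. -/
def AtMostOneCrash {Msg : Type} (S : ℕ → Step n Msg) : Prop :=
  ∀ p q : Fin n, ¬ CorrectProc p S → ¬ CorrectProc q S → p = q

/-- Every message sent to a correct process is eventually received. -/
def FairDelivery (I : Impl n Op Val) (C : Config I) (S : ℕ → Step n I.Msg) : Prop :=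
  ∀ (k : ℕ) (p : Fin n) (m : I.Msg), CorrectProc p S →
    (p, m) ∈ (applyHist I C (prefixSteps S k)).buffer →
    ∃ k' ≥ k, S k' = (p, some m)

/-- `I` is 1-resilient lock-free: for every reachable configuration (reached by a
history `H₀`) with a pending operation by process `p`, and every infinite history
applicable to it in which at most one process crashes, `p` is correct, and every
message sent to a correct process is eventually received, some finite prefix
completes an operation not yet complete. -/
def OneResilientLockFree (I : Impl n Op Val) : Prop :=
  ∀ H₀ ∈ Histories I, ∀ (p : Fin n) (o : Op),
    I.procOf o = p → Pending o (events I H₀) →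
    ∀ S : ℕ → Step n I.Msg,
      InfApplicable I (applyHist I (initConfig I) H₀) S →
      AtMostOneCrash S → CorrectProc p S →
      FairDelivery I (applyHist I (initConfig I) H₀) S →
      ∃ (k : ℕ) (o' : Op),
        Completed o' (events I (H₀ ++ prefixSteps S k)) ∧ ¬ Completed o' (events I H₀)

end MP

namespace MP

/-- The operations of a single-writer single-reader register over values `V`. -/
inductive SWSROp (V : Type) : Type
  | write (v : V)
  | read

/-- Sequential specification of a register over `V` with initial value `v0`:
every read returns the value written by the last write that occurs before it, or the
initial value `v0` if no write occurs before it. -/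
def SWSRSpec {V : Type} (v0 : V) (L : List (Event (SWSROp V) V)) : Prop :=
  ∀ (i : ℕ) (hi : i < L.length) (v : V), L.get ⟨i, hi⟩ = Event.res SWSROp.read v →
    ((∀ (j : ℕ) (hj : j < L.length), j < i →
        ∀ w : V, L.get ⟨j, hj⟩ ≠ Event.inv (SWSROp.write w)) → v = v0) ∧
    (∀ (j : ℕ) (hj : j < L.length) (w : V), j < i →
      L.get ⟨j, hj⟩ = Event.inv (SWSROp.write w) →
      (∀ (j' : ℕ) (hj' : j' < L.length), j < j' → j' < i →
        ∀ w' : V, L.get ⟨j', hj'⟩ ≠ Event.inv (SWSROp.write w')) →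
      v = w)

variable {n : ℕ}

/-- The system obtained by using a SWSR register implementation `I` as a Test-or-Set
object: the distinguished reader `p0` invokes `read` once (as its first step), and the
distinguished writer `p1 ≠ p0` invokes `write v1` once (as its first step); no other
operation is ever invoked, and the other processes only help. -/
structure SWSRAlg {V : Type} (I : Impl n (SWSROp V) V) (p0 p1 : Fin n) (v1 : V) : Prop where
  distinct : p0 ≠ p1
  proc_read : I.procOf SWSROp.read = p0
  proc_write : ∀ w : V, I.procOf (SWSROp.write w) = p1
  events_own : ∀ (p : Fin n) (s s' : I.PState) (ev : Event (SWSROp V) V),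
    I.eventOf p s s' = some ev → I.procOf ev.opOf = p
  wellFormed : WellFormed I
  invokes_read : ∀ m : Option I.Msg,
    I.eventOf p0 (I.init p0) (I.trans p0 (I.init p0) m).1 = some (Event.inv SWSROp.read)
  invokes_write : ∀ m : Option I.Msg,
    I.eventOf p1 (I.init p1) (I.trans p1 (I.init p1) m).1 = some (Event.inv (SWSROp.write v1))
  only_write_v1 : ∀ H ∈ Histories I, ∀ w : V, Invoked (SWSROp.write w) (events I H) → w = v1

end MP

namespace MP

section Runs

variable {n : ℕ} {Op Val : Type} {I : Impl n Op Val}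

theorem applyHist_append (C : Config I) (H K : List (Step n I.Msg)) :
    applyHist I C (H ++ K) = applyHist I (applyHist I C H) K := by
  induction H generalizing C with
  | nil => rfl
  | cons e H ih => exact ih _

theorem applicableHist_append (C : Config I) (H K : List (Step n I.Msg)) :
    ApplicableHist I C (H ++ K) ↔
      ApplicableHist I C H ∧ ApplicableHist I (applyHist I C H) K := by
  induction H generalizing C with
  | nil => simp [ApplicableHist, applyHist]
  | cons e H ih => simp [ApplicableHist, applyHist, ih, and_assoc]

theorem runEvents_append (C : Config I) (H K : List (Step n I.Msg)) :
    runEvents I C (H ++ K) = runEvents I C H ++ runEvents I (applyHist I C H) K := by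
  induction H generalizing C with
  | nil => simp [runEvents, applyHist]
  | cons e H ih => simp [runEvents, applyHist, ih]

theorem mem_histories_append {H K : List (Step n I.Msg)} :
    H ++ K ∈ Histories I ↔
      H ∈ Histories I ∧ ApplicableHist I (applyHist I (initConfig I) H) K :=
  applicableHist_append _ _ _

theorem mem_histories_append_singleton {H : List (Step n I.Msg)} {e : Step n I.Msg} :
    H ++ [e] ∈ Histories I ↔
      H ∈ Histories I ∧ Applicable I (applyHist I (initConfig I) H) e := by
  simp [mem_histories_append, ApplicableHist]

theorem events_append (H K : List (Step n I.Msg)) :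
    events I (H ++ K) = events I H ++ runEvents I (applyHist I (initConfig I) H) K :=
  runEvents_append _ _ _

theorem mem_events_append_left {H K : List (Step n I.Msg)} {ev : Event Op Val}
    (h : ev ∈ events I H) : ev ∈ events I (H ++ K) := by
  rw [events_append]
  exact List.mem_append_left _ h

theorem Completed.append {H : List (Step n I.Msg)} {o : Op} (h : Completed o (events I H))
    (K : List (Step n I.Msg)) : Completed o (events I (H ++ K)) :=
  ⟨mem_events_append_left h.1, h.2.imp fun _ => mem_events_append_left⟩

theorem applicable_none (C : Config I) (p : Fin n) : Applicable I C (p, none) := trivial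

theorem Config.ext {C D : Config I} (hs : C.states = D.states) (hb : C.buffer = D.buffer) :
    C = D := by
  cases C
  cases D
  cases hs
  cases hb
  rfl

/-- A step stays applicable when a different step is taken. -/
theorem Applicable.applyStep {C : Config I} {x e : Step n I.Msg} (hx : Applicable I C x)
    (hne : x ≠ e) : Applicable I (applyStep I C e) x := by
  classical
  obtain ⟨p, mx⟩ := x
  cases mx with
  | none => trivial
  | some m =>
    obtain ⟨q, me⟩ := e
    simp only [Applicable] at hx ⊢
    cases me with
    | none => exact Multiset.mem_add.2 (Or.inl hx)
    | some m' =>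
      refine Multiset.mem_add.2 (Or.inl ?_)
      refine (Multiset.mem_erase_of_ne ?_).2 hx
      intro h
      apply hne
      cases h
      rfl

/-- A step stays applicable until it is taken. -/
theorem Applicable.applyHist {C : Config I} {x : Step n I.Msg} (hx : Applicable I C x)
    {K : List (Step n I.Msg)} (hK : x ∉ K) : Applicable I (applyHist I C K) x := by
  induction K generalizing C with
  | nil => exact hx
  | cons e K ih =>
    simp only [List.mem_cons, not_or] at hK
    exact ih (hx.applyStep hK.1) hK.2

theorem applyStep_states_of_ne {C : Config I} {e : Step n I.Msg} {p : Fin n} (h : p ≠ e.1) :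
    (applyStep I C e).states p = C.states p := by
  simp [applyStep, Function.update_of_ne h]

theorem applyStep_states_self (C : Config I) (e : Step n I.Msg) :
    (applyStep I C e).states e.1 = (I.trans e.1 (C.states e.1) e.2).1 := by
  simp [applyStep]

theorem stepEvent_applyStep_of_ne {C : Config I} {e x : Step n I.Msg} (h : x.1 ≠ e.1) :
    stepEvent I (applyStep I C e) x = stepEvent I C x := by
  simp only [stepEvent, applyStep_states_self, applyStep_states_of_ne h]

/-- Steps of different processes commute. -/
theorem applyStep_comm {C : Config I} {e x : Step n I.Msg} (h : x.1 ≠ e.1)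
    (he : Applicable I C e) (hx : Applicable I C x) :
    applyStep I (applyStep I C e) x = applyStep I (applyStep I C x) e := by
  classical
  obtain ⟨p, me⟩ := e
  obtain ⟨q, mx⟩ := x
  simp only at h
  have hs : (applyStep I (applyStep I C (p, me)) (q, mx)).states =
      (applyStep I (applyStep I C (q, mx)) (p, me)).states := by
    simp only [applyStep, Function.update_of_ne h, Function.update_of_ne h.symm]
    exact Function.update_comm h.symm _ _ _
  have hb : (applyStep I (applyStep I C (p, me)) (q, mx)).buffer =
      (applyStep I (applyStep I C (q, mx)) (p, me)).buffer := by
    simp only [applyStep, Function.update_of_ne h, Function.update_of_ne h.symm]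
    cases me with
    | none =>
      cases mx with
      | none => exact add_right_comm _ _ _
      | some m' =>
        simp only [Applicable] at hx
        simp only [Multiset.erase_add_left_pos _ hx]
        exact add_right_comm _ _ _
    | some m =>
      simp only [Applicable] at he
      cases mx with
      | none =>
        simp only [Multiset.erase_add_left_pos _ he]
        exact add_right_comm _ _ _
      | some m' =>
        simp only [Applicable] at hx
        have h1 : ((q, m') : Fin n × I.Msg) ≠ (p, m) := fun h' => h (Prod.ext_iff.1 h').1
        have hx' := (Multiset.mem_erase_of_ne h1).2 hx
        have he' := (Multiset.mem_erase_of_ne h1.symm).2 he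
        simp only [Multiset.erase_add_left_pos _ hx', Multiset.erase_add_left_pos _ he',
          Multiset.erase_comm C.buffer (p, m) (q, m')]
        exact add_right_comm _ _ _
  exact Config.ext hs hb

/-- A step of a process `p` commutes with a run in which `p` takes no step. -/
theorem swap_step_run {C : Config I} {e : Step n I.Msg} {K : List (Step n I.Msg)}
    (hK : ∀ x ∈ K, x.1 ≠ e.1) (he : Applicable I C e) (happ : ApplicableHist I C K) :
    ApplicableHist I (applyStep I C e) K ∧
      applyHist I (applyStep I C e) K = applyStep I (applyHist I C K) e ∧
      runEvents I (applyStep I C e) K = runEvents I C K ∧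
      stepEvent I (applyHist I C K) e = stepEvent I C e := by
  induction K generalizing C with
  | nil => exact ⟨trivial, rfl, rfl, rfl⟩
  | cons x K ih =>
    have hxe : x.1 ≠ e.1 := hK x (by simp)
    have hne : x ≠ e := fun h => hxe (by rw [h])
    obtain ⟨hx, hK'⟩ := happ
    obtain ⟨h1, h2, h3, h4⟩ :=
      ih (fun y hy => hK y (by simp [hy])) (he.applyStep hne.symm) hK'
    rw [applyStep_comm hxe.symm hx he] at h1 h2 h3
    refine ⟨⟨hx.applyStep hne, h1⟩, h2, ?_, ?_⟩
    · simp only [runEvents, stepEvent_applyStep_of_ne hxe, h3]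
    · simp only [applyHist, h4, stepEvent_applyStep_of_ne hxe.symm]

/-- Two histories are equivalent if they lead to the same configuration and contain the
same operation events. -/
structure HistEquiv (H K : List (Step n I.Msg)) : Prop where
  config_eq : applyHist I (initConfig I) H = applyHist I (initConfig I) K
  mem_events_iff : ∀ ev, ev ∈ events I H ↔ ev ∈ events I K

theorem HistEquiv.symm {H K : List (Step n I.Msg)} (h : HistEquiv H K) : HistEquiv K H :=
  ⟨h.config_eq.symm, fun ev => (h.mem_events_iff ev).symm⟩

theorem HistEquiv.trans {H K L : List (Step n I.Msg)} (h : HistEquiv H K)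
    (h' : HistEquiv K L) : HistEquiv H L :=
  ⟨h.config_eq.trans h'.config_eq,
    fun ev => (h.mem_events_iff ev).trans (h'.mem_events_iff ev)⟩

theorem HistEquiv.append {H K : List (Step n I.Msg)} (h : HistEquiv H K)
    (L : List (Step n I.Msg)) : HistEquiv (H ++ L) (K ++ L) := by
  refine ⟨by rw [applyHist_append, applyHist_append, h.config_eq], fun ev => ?_⟩
  simp only [events_append, List.mem_append, h.config_eq, h.mem_events_iff]

theorem histEquiv_swap {H K : List (Step n I.Msg)} {e : Step n I.Msg}
    (hK : ∀ x ∈ K, x.1 ≠ e.1) (he : H ++ [e] ∈ Histories I) (hHK : H ++ K ∈ Histories I) :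
    H ++ [e] ++ K ∈ Histories I ∧ H ++ K ++ [e] ∈ Histories I ∧
      HistEquiv (H ++ [e] ++ K) (H ++ K ++ [e]) := by
  have he' := (mem_histories_append_singleton.1 he).2
  obtain ⟨h1, h2, h3, h4⟩ := swap_step_run hK he' (mem_histories_append.1 hHK).2
  refine ⟨mem_histories_append.2 ⟨he, ?_⟩, mem_histories_append_singleton.2 ⟨hHK, ?_⟩, ?_, ?_⟩
  · simpa [applyHist_append, applyHist] using h1
  · rw [applyHist_append]
    exact he'.applyHist fun h => hK e h rfl
  · simpa [applyHist_append, applyHist] using h2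
  · intro ev
    simp only [events_append, applyHist_append, applyHist, runEvents, h3, h4]
    simp [or_comm]

/-- Every event is an event of an operation of some process that takes a step. -/
theorem exists_step_of_mem_runEvents
    (hown : ∀ (p : Fin n) (s s' : I.PState) (ev : Event Op Val),
      I.eventOf p s s' = some ev → I.procOf ev.opOf = p)
    {C : Config I} {H : List (Step n I.Msg)} {ev : Event Op Val} (h : ev ∈ runEvents I C H) :
    ∃ e ∈ H, e.1 = I.procOf ev.opOf := by
  induction H generalizing C with
  | nil => simp [runEvents] at h
  | cons e H ih =>
    simp only [runEvents, List.mem_append, Option.mem_toList] at h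
    rcases h with h | h
    · exact ⟨e, by simp, (hown _ _ _ _ h).symm⟩
    · obtain ⟨x, hx, hxp⟩ := ih h
      exact ⟨x, by simp [hx], hxp⟩

/-- If the first step of `p` invokes `o`, then `o` is invoked once `p` takes a step. -/
theorem inv_mem_events_of_step {p : Fin n} {o : Op}
    (hinv : ∀ m : Option I.Msg,
      I.eventOf p (I.init p) (I.trans p (I.init p) m).1 = some (Event.inv o))
    {H : List (Step n I.Msg)} (h : ∃ e ∈ H, e.1 = p) : Event.inv o ∈ events I H := by
  suffices hs : ∀ C : Config I, C.states p = I.init p → Event.inv o ∈ runEvents I C H from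
    hs _ rfl
  induction H with
  | nil => simp at h
  | cons x H ih =>
    intro C hC
    simp only [runEvents, List.mem_append, Option.mem_toList]
    by_cases hx : x.1 = p
    · left
      subst hx
      rw [stepEvent, applyStep_states_self, hC]
      exact hinv _
    · right
      obtain ⟨e, he, hep⟩ := h
      refine ih ⟨e, ?_, hep⟩ _ ((applyStep_states_of_ne (Ne.symm hx)).trans hC)
      rcases List.mem_cons.1 he with rfl | he
      · exact absurd hep hx
      · exact he

theorem length_prefixSteps {β : Type*} (S : ℕ → β) (k : ℕ) : (prefixSteps S k).length = k := by
  simp [prefixSteps]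

theorem prefixSteps_succ {β : Type*} (S : ℕ → β) (k : ℕ) :
    prefixSteps S (k + 1) = prefixSteps S k ++ [S k] := by
  simp [prefixSteps, List.range_succ]

theorem prefixSteps_mem_histories {H : List (Step n I.Msg)} (hH : H ∈ Histories I)
    {S : ℕ → Step n I.Msg} (hS : InfApplicable I (applyHist I (initConfig I) H) S) (k : ℕ) :
    H ++ prefixSteps S k ∈ Histories I := by
  induction k with
  | zero => simpa [prefixSteps] using hH
  | succ k ih =>
    rw [prefixSteps_succ, ← List.append_assoc, mem_histories_append_singleton]
    exact ⟨ih, by simpa [applyHist_append] using hS k⟩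

end Runs

section Scheduler

variable {n : ℕ} {Op Val : Type} {I : Impl n Op Val}
  {P : List (Step n I.Msg) → Prop} {A : Fin n → Prop}

theorem exists_extension_of_list
    (hext : ∀ H, P H → ∀ e : Step n I.Msg, A e.1 →
      Applicable I (applyHist I (initConfig I) H) e →
      ∃ K, P (H ++ K) ∧ e ∈ K ∧ ∀ x ∈ K, A x.1)
    (T : List (Step n I.Msg)) (H : List (Step n I.Msg)) (hH : P H) :
    ∃ K, P (H ++ K) ∧ (∀ x ∈ K, A x.1) ∧
      ∀ e ∈ T, A e.1 → Applicable I (applyHist I (initConfig I) H) e → e ∈ K := by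
  induction T generalizing H with
  | nil => exact ⟨[], by simpa using hH, by simp, by simp⟩
  | cons e T ih =>
    obtain ⟨K₁, hP₁, hA₁, he₁⟩ : ∃ K, P (H ++ K) ∧ (∀ x ∈ K, A x.1) ∧
        (A e.1 → Applicable I (applyHist I (initConfig I) H) e → e ∈ K) := by
      by_cases he : A e.1 ∧ Applicable I (applyHist I (initConfig I) H) e
      · obtain ⟨K, h1, h2, h3⟩ := hext H hH e he.1 he.2
        exact ⟨K, h1, h3, fun _ _ => h2⟩
      · exact ⟨[], by simpa using hH, by simp, fun h h' => absurd ⟨h, h'⟩ he⟩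
    obtain ⟨K₂, hP₂, hA₂, hT₂⟩ := ih _ hP₁
    refine ⟨K₁ ++ K₂, by simpa using hP₂, ?_, ?_⟩
    · intro x hx
      exact (List.mem_append.1 hx).elim (hA₁ x) (hA₂ x)
    · intro x hx hxA hxapp
      rw [List.mem_append]
      rcases List.mem_cons.1 hx with rfl | hx
      · exact Or.inl (he₁ hxA hxapp)
      · by_cases h : x ∈ K₁
        · exact Or.inl h
        · refine Or.inr (hT₂ x hx hxA ?_)
          rw [applyHist_append]
          exact hxapp.applyHist h

theorem exists_round
    (hext : ∀ H, P H → ∀ e : Step n I.Msg, A e.1 →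
      Applicable I (applyHist I (initConfig I) H) e →
      ∃ K, P (H ++ K) ∧ e ∈ K ∧ ∀ x ∈ K, A x.1)
    (H : List (Step n I.Msg)) (hH : P H) :
    ∃ K, P (H ++ K) ∧ (∀ x ∈ K, A x.1) ∧
      ∀ e : Step n I.Msg, A e.1 → Applicable I (applyHist I (initConfig I) H) e → e ∈ K := by
  obtain ⟨K, h1, h2, h3⟩ := exists_extension_of_list hext
    ((List.finRange n).map (fun p => (p, none)) ++
      (applyHist I (initConfig I) H).buffer.toList.map (fun x => (x.1, some x.2))) H hH
  refine ⟨K, h1, h2, fun e he happ => h3 e ?_ he happ⟩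
  obtain ⟨p, m⟩ := e
  rw [List.mem_append]
  cases m with
  | none => exact Or.inl (List.mem_map.2 ⟨p, List.mem_finRange p, rfl⟩)
  | some m => exact Or.inr (List.mem_map.2 ⟨(p, m), Multiset.mem_toList.2 happ, rfl⟩)

/-- If every history satisfying `P` can be extended to one satisfying `P` so as to include
any given applicable step of a process in `A`, then there is an infinite fair run in which
exactly the processes in `A` are correct and `P` holds infinitely often. -/
theorem exists_fair_run (hPH : ∀ H, P H → H ∈ Histories I) (hA : ∃ p, A p)
    (hext : ∀ H, P H → ∀ e : Step n I.Msg, A e.1 →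
      Applicable I (applyHist I (initConfig I) H) e →
      ∃ K, P (H ++ K) ∧ e ∈ K ∧ ∀ x ∈ K, A x.1)
    (H₀ : List (Step n I.Msg)) (hH₀ : P H₀) :
    ∃ S : ℕ → Step n I.Msg,
      InfApplicable I (applyHist I (initConfig I) H₀) S ∧
      (∀ k, A (S k).1) ∧
      (∀ p, A p → CorrectProc p S) ∧
      FairDelivery I (applyHist I (initConfig I) H₀) S ∧
      ∀ k, ∃ k' ≥ k, P (H₀ ++ prefixSteps S k') := by
  obtain ⟨a, ha⟩ := hA
  have hround : ∀ R : {R : List (Step n I.Msg) // P (H₀ ++ R)}, ∃ K : List (Step n I.Msg),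
      P (H₀ ++ (R.1 ++ K)) ∧ (∀ x ∈ K, A x.1) ∧
      ∀ e : Step n I.Msg, A e.1 → Applicable I (applyHist I (initConfig I) (H₀ ++ R.1)) e →
        e ∈ K := by
    intro R
    simpa using exists_round hext (H₀ ++ R.1) R.2
  choose next hnextP hnextA hnextE using hround
  let G : ℕ → {R : List (Step n I.Msg) // P (H₀ ++ R)} := fun k =>
    Nat.rec ⟨[], by simpa using hH₀⟩ (fun _ R => ⟨R.1 ++ next R, hnextP R⟩) k
  have hG : ∀ k, (G (k + 1)).1 = (G k).1 ++ next (G k) := fun _ => rfl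
  have hlen : ∀ k, k ≤ (G k).1.length := by
    intro k
    induction k with
    | zero => exact Nat.zero_le _
    | succ k ih =>
      have := List.length_pos_of_mem (hnextE (G k) (a, none) ha (applicable_none _ _))
      rw [hG, List.length_append]
      omega
  have hpre : ∀ i j, i ≤ j → (G i).1 <+: (G j).1 := by
    intro i j hij
    induction hij with
    | refl => exact List.prefix_rfl
    | step _ ih => exact ih.trans (by rw [hG]; exact List.prefix_append _ _)
  have hGA : ∀ k, ∀ x ∈ (G k).1, A x.1 := by
    intro k
    induction k with
    | zero => intro x hx; simp [G] at hx
    | succ k ih =>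
      intro x hx
      rw [hG] at hx
      exact (List.mem_append.1 hx).elim (ih x) (hnextA _ x)
  let S : ℕ → Step n I.Msg := fun k => (G (k + 1)).1[k]'(hlen (k + 1))
  have hS : ∀ j k (h : k < (G j).1.length), (G j).1[k] = S k := by
    intro j k h
    rcases le_total j (k + 1) with hj | hj
    · exact (hpre _ _ hj).getElem h
    · exact ((hpre _ _ hj).getElem (hlen (k + 1))).symm
  have htake : ∀ j k, k ≤ (G j).1.length → prefixSteps S k = (G j).1.take k := by
    intro j k h
    refine List.ext_getElem (by simp [length_prefixSteps, h]) fun i h1 h2 => ?_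
    simp only [prefixSteps, List.getElem_map, List.getElem_range, List.getElem_take]
    exact (hS j i _).symm
  have hdrop : ∀ j k (e : Step n I.Msg), e ∈ (G j).1.drop k → ∃ k' ≥ k, S k' = e := by
    intro j k e he
    obtain ⟨i, hi, rfl⟩ := List.mem_iff_getElem.1 he
    refine ⟨k + i, Nat.le_add_right _ _, ?_⟩
    rw [List.getElem_drop]
    exact (hS j _ _).symm
  have hev : ∀ (k : ℕ) (e : Step n I.Msg), A e.1 →
      Applicable I (applyHist I (applyHist I (initConfig I) H₀) (prefixSteps S k)) e →
      ∃ k' ≥ k, S k' = e := by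
    intro k e heA happ
    apply hdrop (k + 1) k
    rw [hG, List.drop_append_of_le_length (hlen k), List.mem_append]
    by_cases h : e ∈ (G k).1.drop k
    · exact Or.inl h
    · right
      apply hnextE _ _ heA
      have := happ.applyHist h
      rw [← applyHist_append, ← applyHist_append, htake k k (hlen k), List.take_append_drop] at this
      exact this
  have hSA : ∀ k, A (S k).1 := fun k => hGA (k + 1) _ (List.getElem_mem _)
  refine ⟨S, ?_, hSA, ?_, ?_, ?_⟩
  · intro k
    have h1 : H₀ ++ (G (k + 1)).1 ∈ Histories I := hPH _ (G (k + 1)).2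
    rw [← List.take_append_drop (k + 1) (G (k + 1)).1, ← htake (k + 1) (k + 1) (hlen _),
      ← List.append_assoc, mem_histories_append, prefixSteps_succ, ← List.append_assoc,
      mem_histories_append_singleton, applyHist_append] at h1
    exact h1.1.2
  · intro p hp k
    obtain ⟨k', hk', h⟩ := hev k (p, none) hp (applicable_none _ _)
    exact ⟨k', hk', by rw [h]⟩
  · intro k p m hp hm
    obtain ⟨k₁, -, h₁⟩ := hp 0
    exact hev k (p, some m) (h₁ ▸ hSA k₁) hm
  · intro k
    refine ⟨(G k).1.length, hlen k, ?_⟩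
    rw [htake k _ le_rfl, List.take_length]
    exact (G k).2

/-- In a 1-resilient lock-free implementation, if `o` is pending and its process belongs to
a set `A` of processes that misses at most one process, then steps of processes in `A` can
complete some operation. -/
theorem OneResilientLockFree.exists_completion (hlf : OneResilientLockFree I)
    (hA : ∀ p q, ¬ A p → ¬ A q → p = q) {o : Op} (ho : A (I.procOf o))
    {H : List (Step n I.Msg)} (hH : H ∈ Histories I) (hpend : Pending o (events I H)) :
    ∃ (K : List (Step n I.Msg)) (o' : Op), H ++ K ∈ Histories I ∧ (∀ x ∈ K, A x.1) ∧
      Completed o' (events I (H ++ K)) ∧ ¬ Completed o' (events I H) := by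
  obtain ⟨S, hS, hSA, hcorr, hfair, -⟩ := exists_fair_run (I := I) (P := (· ∈ Histories I))
    (A := A) (fun _ h => h) ⟨_, ho⟩
    (fun H hH e he happ =>
      ⟨[e], mem_histories_append_singleton.2 ⟨hH, happ⟩, by simp, by simpa using he⟩) H hH
  obtain ⟨k, o', h1, h2⟩ := hlf H hH _ o rfl hpend S hS
    (fun p q hp hq => hA p q (fun h => hp (hcorr p h)) (fun h => hq (hcorr q h)))
    (hcorr _ ho) hfair
  refine ⟨prefixSteps S k, o', prefixSteps_mem_histories hH hS k, ?_, h1, h2⟩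
  intro x hx
  obtain ⟨i, -, rfl⟩ := List.mem_map.1 hx
  exact hSA i

end Scheduler

section Linearization

variable {n : ℕ} {Op Val : Type} {I : Impl n Op Val} {Spec : List (Event Op Val) → Prop}
  {f : List (Step n I.Msg) → List (Event Op Val)} {H : List (Step n I.Msg)}

theorem IsLinearizationFn.inv_mem_events (hf : IsLinearizationFn I Spec f)
    (hH : H ∈ Histories I) {o : Op} (h : Event.inv o ∈ f H) : Event.inv o ∈ events I H := by
  obtain ⟨-, ⟨L', ⟨removed, R, -, hR, -, -, rfl⟩, hmem, -⟩, -⟩ := hf H hH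
  rcases List.mem_append.1 ((hmem _).1 h) with h | h
  · exact (List.mem_filter.1 h).1
  · obtain ⟨_, _, h, _⟩ := hR _ h
    cases h

theorem IsLinearizationFn.mem_of_completed (hf : IsLinearizationFn I Spec f)
    (hH : H ∈ Histories I) {ev : Event Op Val} (hev : ev ∈ events I H)
    (hc : ∃ v, Event.res ev.opOf v ∈ events I H) : ev ∈ f H := by
  obtain ⟨-, ⟨L', ⟨removed, R, hrem, -, -, -, rfl⟩, hmem, -⟩, -⟩ := hf H hH
  refine (hmem _).2 (List.mem_append_left _ (List.mem_filter.2 ⟨hev, ?_⟩))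
  obtain ⟨v, hv⟩ := hc
  have : removed ev.opOf ≠ true := fun h => (hrem _ h).2 v hv
  simpa using this

theorem IsLinearizationFn.res_unique (hf : IsLinearizationFn I Spec f)
    (hwf : WellFormed I) (hH : H ∈ Histories I) {o : Op} {v v' : Val}
    (hv : Event.res o v ∈ events I H) (hv' : Event.res o v' ∈ f H) : v' = v := by
  obtain ⟨-, ⟨L', ⟨removed, R, -, hR, -, -, rfl⟩, hmem, -⟩, -⟩ := hf H hH
  rcases List.mem_append.1 ((hmem _).1 hv') with h | h
  · have h' := (List.mem_filter.1 h).1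
    obtain ⟨i, hi, hiv⟩ := List.mem_iff_getElem.1 hv
    obtain ⟨j, hj, hjv⟩ := List.mem_iff_getElem.1 h'
    have := (hwf H hH).2.1 o i j hi hj v v' hiv hjv
    subst this
    rw [hiv] at hjv
    cases hjv
    rfl
  · obtain ⟨o', _, h, hp, _⟩ := hR _ h
    cases h
    exact absurd hv (hp.2 v)

theorem Sequential.exists_inv_cons {L : List (Event Op Val)} (h : Sequential L) (hne : L ≠ []) :
    ∃ o L', L = Event.inv o :: L' := by
  match L, h, hne with
  | Event.inv o :: L', _, _ => exact ⟨o, L', rfl⟩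
  | Event.res o v :: L', h, _ => simp [Sequential] at h

end Linearization

section Register

variable {n : ℕ} {V : Type} {v0 v1 : V}

theorem SWSRSpec.eq_of_write_first {w v : V} {L : List (Event (SWSROp V) V)}
    (hspec : SWSRSpec v0 (Event.inv (SWSROp.write w) :: L))
    (hw : ∀ w', Event.inv (SWSROp.write w') ∈ Event.inv (SWSROp.write w) :: L → w' = v1)
    (hv : Event.res SWSROp.read v ∈ L) : v = v1 := by
  classical
  obtain ⟨i, hi, hiv⟩ :=
    List.mem_iff_getElem.1 (List.mem_cons_of_mem (Event.inv (SWSROp.write w)) hv)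
  set L' := Event.inv (SWSROp.write w) :: L with hL'
  let Q : ℕ → Prop := fun j => j < i ∧ ∃ (hj : j < L'.length) (w' : V),
    L'.get ⟨j, hj⟩ = Event.inv (SWSROp.write w')
  have hi0 : 0 < i := by
    rcases Nat.eq_zero_or_pos i with rfl | h
    · simp at hiv
    · exact h
  have hQ0 : Q 0 := ⟨hi0, by simp [hL'], w, by simp [hL']⟩
  obtain ⟨hlt, hj, w', hw'⟩ := Nat.findGreatest_spec (P := Q) (Nat.zero_le i) hQ0
  have := (hspec i hi v hiv).2 _ hj w' hlt hw' fun j' hj' h1 h2 w'' h3 =>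
    Nat.findGreatest_is_greatest h1 h2.le ⟨h2, hj', w'', h3⟩
  rw [this]
  exact hw w' (hw' ▸ List.get_mem _ _)

/-- `v` is a possible return value of the read in extensions of the history `H`. -/
def CanRead {Op : Type} {I : Impl n Op V} (o : Op) (H : List (Step n I.Msg)) (v : V) : Prop :=
  ∃ K, H ++ K ∈ Histories I ∧ Event.res o v ∈ events I (H ++ K)

theorem CanRead.of_append {Op : Type} {I : Impl n Op V} {o : Op} {H K : List (Step n I.Msg)}
    {v : V} (h : CanRead o (H ++ K) v) : CanRead o H v := by
  obtain ⟨L, h1, h2⟩ := h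
  exact ⟨K ++ L, by simpa using h1, by simpa using h2⟩

theorem HistEquiv.canRead {Op : Type} {I : Impl n Op V} {o : Op} {H K : List (Step n I.Msg)}
    (hHK : HistEquiv H K) (hK : K ∈ Histories I) {v : V} (h : CanRead o H v) :
    CanRead o K v := by
  obtain ⟨L, h1, h2⟩ := h
  refine ⟨L, mem_histories_append.2 ⟨hK, ?_⟩, ((hHK.append L).mem_events_iff _).1 h2⟩
  rw [← hHK.config_eq]
  exact (mem_histories_append.1 h1).2

/-- Two different values are possible return values of the read after `H`. -/
def Bivalent {Op : Type} {I : Impl n Op V} (o : Op) (H : List (Step n I.Msg)) : Prop :=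
  H ∈ Histories I ∧ ∃ u v, u ≠ v ∧ CanRead o H u ∧ CanRead o H v

variable {I : Impl n (SWSROp V) V} {p0 p1 : Fin n}
  {f : List (Step n I.Msg) → List (Event (SWSROp V) V)} {H : List (Step n I.Msg)}

theorem SWSRAlg.invoked_iff (alg : SWSRAlg I p0 p1 v1) (hH : H ∈ Histories I) {o : SWSROp V}
    (h : Event.inv o ∈ events I H) : o = SWSROp.read ∨ o = SWSROp.write v1 := by
  cases o with
  | read => exact Or.inl rfl
  | write w => exact Or.inr (by rw [alg.only_write_v1 H hH w h])

theorem ne_nil_of_completed (hf : IsLinearizationFn I (SWSRSpec v0) f) (hH : H ∈ Histories I)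
    {o : SWSROp V} (h : Completed o (events I H)) : f H ≠ [] :=
  List.ne_nil_of_mem (hf.mem_of_completed hH h.1 h.2)

/-- The first operation of the linearization determines the value of the read. -/
theorem eq_of_linearization_head (alg : SWSRAlg I p0 p1 v1)
    (hf : IsLinearizationFn I (SWSRSpec v0) f)
    (hpre : ∀ G H, G ∈ Histories I → H ∈ Histories I → G <+: H → f G <+: f H)
    (hH : H ∈ Histories I) {o : SWSROp V} {L : List (Event (SWSROp V) V)}
    (hL : f H = Event.inv o :: L) {v : V} (hv : CanRead SWSROp.read H v) :
    (o = SWSROp.read ∧ v = v0) ∨ (o = SWSROp.write v1 ∧ v = v1) := by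
  obtain ⟨K, hK, hres⟩ := hv
  obtain ⟨L', hL'⟩ : ∃ L', f (H ++ K) = Event.inv o :: L' := by
    obtain ⟨M, hM⟩ := hpre _ _ hH hK (List.prefix_append _ _)
    exact ⟨L ++ M, by rw [← hM, hL]; rfl⟩
  have hmem : Event.res SWSROp.read v ∈ f (H ++ K) := hf.mem_of_completed hK hres ⟨v, hres⟩
  obtain ⟨hseq, -, hspec⟩ := hf _ hK
  have hino : Event.inv o ∈ events I H := hf.inv_mem_events hH (by simp [hL])
  rcases alg.invoked_iff hH hino with rfl | rfl
  · refine Or.inl ⟨rfl, ?_⟩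
    rw [hL'] at hmem hseq hspec
    match L', hmem, hseq with
    | Event.res o' v' :: M, hmem, hseq =>
      simp only [Sequential] at hseq
      obtain ⟨rfl, -⟩ := hseq
      have h1 : v' = v := hf.res_unique alg.wellFormed hK hres (by simp [hL'])
      rw [← h1]
      refine (hspec 1 (by simp) v' rfl).1 fun j hj hj1 w => ?_
      obtain rfl : j = 0 := by omega
      simp
    | [], hmem, hseq => simp at hmem
    | Event.inv o' :: M, hmem, hseq => simp [Sequential] at hseq
  · refine Or.inr ⟨rfl, ?_⟩
    rw [hL'] at hspec hmem
    refine hspec.eq_of_write_first (fun w' hw' => ?_) (by simpa using hmem)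
    exact alg.only_write_v1 _ hK w' (hf.inv_mem_events hK (hL' ▸ hw'))

theorem canRead_unique (alg : SWSRAlg I p0 p1 v1) (hf : IsLinearizationFn I (SWSRSpec v0) f)
    (hpre : ∀ G H, G ∈ Histories I → H ∈ Histories I → G <+: H → f G <+: f H)
    (hH : H ∈ Histories I) (hne : f H ≠ []) {u v : V} (hu : CanRead SWSROp.read H u)
    (hv : CanRead SWSROp.read H v) : u = v := by
  obtain ⟨o, L, hL⟩ := (hf H hH).1.exists_inv_cons hne
  have h1 := eq_of_linearization_head alg hf hpre hH hL hu
  have h2 := eq_of_linearization_head alg hf hpre hH hL hv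
  rcases h1 with ⟨rfl, rfl⟩ | ⟨rfl, rfl⟩ <;> rcases h2 with ⟨h, rfl⟩ | ⟨h, rfl⟩ <;> simp_all

theorem Bivalent.not_completed (alg : SWSRAlg I p0 p1 v1)
    (hf : IsLinearizationFn I (SWSRSpec v0) f)
    (hpre : ∀ G H, G ∈ Histories I → H ∈ Histories I → G <+: H → f G <+: f H)
    (hbiv : Bivalent SWSROp.read H) (o : SWSROp V) : ¬ Completed o (events I H) := by
  obtain ⟨hH, u, v, huv, hu, hv⟩ := hbiv
  exact fun h => huv (canRead_unique alg hf hpre hH (ne_nil_of_completed hf hH h) hu hv)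

/-- Processes of a set `A` missing at most one process can complete some operation, as long
as an operation of a process in `A` is not complete. -/
theorem SWSRAlg.exists_completion (alg : SWSRAlg I p0 p1 v1) (hlf : OneResilientLockFree I)
    {A : Fin n → Prop} (hA : ∀ p q, ¬ A p → ¬ A q → p = q) {o : SWSROp V}
    (ho : o = SWSROp.read ∨ o = SWSROp.write v1) (hoA : A (I.procOf o))
    (hH : H ∈ Histories I) (hnc : ¬ Completed o (events I H)) :
    ∃ (K : List (Step n I.Msg)) (o' : SWSROp V), H ++ K ∈ Histories I ∧ (∀ x ∈ K, A x.1) ∧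
      Completed o' (events I (H ++ K)) ∧ ¬ Completed o' (events I H) := by
  have hH' : H ++ [(I.procOf o, none)] ∈ Histories I :=
    mem_histories_append_singleton.2 ⟨hH, applicable_none _ _⟩
  have hinv : Event.inv o ∈ events I (H ++ [(I.procOf o, none)]) := by
    rcases ho with rfl | rfl
    · exact inv_mem_events_of_step alg.invokes_read
        ⟨(I.procOf _, none), by simp, alg.proc_read⟩
    · exact inv_mem_events_of_step alg.invokes_write
        ⟨(I.procOf _, none), by simp, alg.proc_write v1⟩
  by_cases hc : Completed o (events I (H ++ [(I.procOf o, none)]))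
  · exact ⟨_, o, hH', by simpa using hoA, hc, hnc⟩
  · have hpend : Pending o (events I (H ++ [(I.procOf o, none)])) :=
      ⟨hinv, fun v hv => hc ⟨hinv, v, hv⟩⟩
    obtain ⟨K, o', h1, h2, h3, h4⟩ := hlf.exists_completion hA hoA hH' hpend
    refine ⟨[(I.procOf o, none)] ++ K, o', by simpa using h1, ?_, by simpa using h3,
      fun h => h4 (h.append _)⟩
    intro x hx
    rcases List.mem_append.1 hx with hx | hx
    · rw [List.mem_singleton.1 hx]
      exact hoA
    · exact h2 x hx

theorem exists_canRead (alg : SWSRAlg I p0 p1 v1) (hlf : OneResilientLockFree I)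
    (hH : H ∈ Histories I) : ∃ v, CanRead SWSROp.read H v := by
  have key : ∀ H ∈ Histories I, Completed SWSROp.read (events I H) →
      ∃ v, CanRead SWSROp.read H v := by
    rintro H hH ⟨-, v, hv⟩
    exact ⟨v, [], by simpa using hH, by simpa using hv⟩
  have step : ∀ H ∈ Histories I, (∃ v, CanRead SWSROp.read H v) ∨
      ∃ K, H ++ K ∈ Histories I ∧ Completed (SWSROp.write v1) (events I (H ++ K)) ∧
        ¬ Completed (SWSROp.write v1) (events I H) := by
    intro H hH
    by_cases hc : Completed SWSROp.read (events I H)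
    · exact Or.inl (key H hH hc)
    · obtain ⟨K, o, h1, -, h3, h4⟩ := alg.exists_completion hlf (A := fun _ => True)
        (by simp) (Or.inl rfl) trivial hH hc
      rcases alg.invoked_iff h1 h3.1 with rfl | rfl
      · exact Or.inl ((key _ h1 h3).imp fun _ => CanRead.of_append)
      · exact Or.inr ⟨K, h1, h3, h4⟩
  rcases step H hH with h | ⟨K, hK, hc, -⟩
  · exact h
  · rcases step _ hK with h | ⟨-, -, -, hnc⟩
    · exact h.imp fun _ => CanRead.of_append
    · exact absurd hc hnc

theorem bivalent_nil (hv : v0 ≠ v1) (alg : SWSRAlg I p0 p1 v1) (hlf : OneResilientLockFree I)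
    (hf : IsLinearizationFn I (SWSRSpec v0) f)
    (hpre : ∀ G H, G ∈ Histories I → H ∈ Histories I → G <+: H → f G <+: f H) :
    Bivalent (I := I) SWSROp.read [] := by
  have hnil : ([] : List (Step n I.Msg)) ∈ Histories I := trivial
  have hnot : ∀ o : SWSROp V, ¬ Completed o (events I ([] : List (Step n I.Msg))) := by
    rintro o ⟨h, -⟩
    simp [events, runEvents] at h
  have solo : ∀ (q : Fin n) (o : SWSROp V), o = SWSROp.read ∨ o = SWSROp.write v1 →
      I.procOf o ≠ q → ∃ (K : List (Step n I.Msg)) (o' : SWSROp V) (L : List _),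
        K ∈ Histories I ∧ I.procOf o' ≠ q ∧ f K = Event.inv o' :: L := by
    intro q o ho hoq
    obtain ⟨K, o', h1, h2, h3, -⟩ := alg.exists_completion hlf (A := (· ≠ q))
      (fun p p' hp hp' => (not_not.1 hp).trans (not_not.1 hp').symm) ho hoq hnil (hnot o)
    rw [List.nil_append] at h1 h3
    obtain ⟨o'', L, hL⟩ := (hf _ h1).1.exists_inv_cons (ne_nil_of_completed hf h1 h3)
    refine ⟨K, o'', L, h1, ?_, hL⟩
    obtain ⟨e, he, heq⟩ := exists_step_of_mem_runEvents alg.events_own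
      (hf.inv_mem_events h1 (o := o'') (by simp [hL]))
    rw [← show e.1 = I.procOf o'' from heq]
    exact h2 e he
  refine ⟨hnil, v0, v1, hv, ?_, ?_⟩
  · obtain ⟨K, o, L, hK, ho, hL⟩ := solo p1 SWSROp.read (Or.inl rfl)
      (by rw [alg.proc_read]; exact alg.distinct)
    obtain ⟨v, hvK⟩ := exists_canRead alg hlf hK
    rcases eq_of_linearization_head alg hf hpre hK hL hvK with ⟨-, rfl⟩ | ⟨rfl, -⟩
    · exact CanRead.of_append (H := []) hvK
    · exact absurd (alg.proc_write v1) ho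
  · obtain ⟨K, o, L, hK, ho, hL⟩ := solo p0 (SWSROp.write v1) (Or.inr rfl)
      (by rw [alg.proc_write]; exact alg.distinct.symm)
    obtain ⟨v, hvK⟩ := exists_canRead alg hlf hK
    rcases eq_of_linearization_head alg hf hpre hK hL hvK with ⟨rfl, -⟩ | ⟨-, rfl⟩
    · exact absurd alg.proc_read ho
    · exact CanRead.of_append (H := []) hvK

/-- Neighbouring histories share a possible return value of the read. -/
theorem exists_common_canRead (alg : SWSRAlg I p0 p1 v1) (hlf : OneResilientLockFree I)
    (hf : IsLinearizationFn I (SWSRSpec v0) f)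
    (hpre : ∀ G H, G ∈ Histories I → H ∈ Histories I → G <+: H → f G <+: f H)
    {e e' : Step n I.Msg} (he : H ++ [e] ∈ Histories I) (he' : H ++ [e'] ∈ Histories I)
    (hne : e ≠ e') :
    ∃ u, CanRead SWSROp.read (H ++ [e]) u ∧ CanRead SWSROp.read (H ++ [e'] ++ [e]) u := by
  have hH : H ∈ Histories I := (mem_histories_append.1 he).1
  have hee : H ++ [e'] ++ [e] ∈ Histories I := by
    rw [mem_histories_append_singleton, applyHist_append]
    exact ⟨he', (mem_histories_append_singleton.1 he).2.applyStep hne⟩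
  by_cases hp : e.1 = e'.1
  · obtain ⟨K, hK, hKp, hfK⟩ : ∃ K, H ++ K ∈ Histories I ∧ (∀ x ∈ K, x.1 ≠ e.1) ∧
        f (H ++ K) ≠ [] := by
      obtain ⟨o, ho, hoe⟩ : ∃ o : SWSROp V, (o = SWSROp.read ∨ o = SWSROp.write v1) ∧
          I.procOf o ≠ e.1 := by
        by_cases h : p0 = e.1
        · exact ⟨_, Or.inr rfl, by rw [alg.proc_write, ← h]; exact alg.distinct.symm⟩
        · exact ⟨_, Or.inl rfl, by rwa [alg.proc_read]⟩
      by_cases hc : Completed o (events I H)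
      · exact ⟨[], by simpa using hH, by simp, by simpa using ne_nil_of_completed hf hH hc⟩
      · obtain ⟨K, o', h1, h2, h3, -⟩ := alg.exists_completion hlf (A := (· ≠ e.1))
          (fun p p' hp hp' => (not_not.1 hp).trans (not_not.1 hp').symm) ho hoe hH hc
        exact ⟨K, h1, h2, ne_nil_of_completed hf h1 h3⟩
    obtain ⟨h1, h2, h3⟩ := histEquiv_swap hKp he hK
    obtain ⟨h1', h2', h3'⟩ := histEquiv_swap (e := e') (by rwa [← hp]) he' hK
    obtain ⟨h1'', h2'', h3''⟩ := histEquiv_swap hKp hee h1'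
    have h4 := h3''.trans (h3'.append [e])
    have h5 : H ++ K ++ [e'] ++ [e] ∈ Histories I := by
      rw [mem_histories_append, ← h3'.config_eq]
      exact ⟨h2', (mem_histories_append.1 h2'').2⟩
    obtain ⟨u, hu⟩ := exists_canRead alg hlf h2
    obtain ⟨u', hu'⟩ := exists_canRead alg hlf h5
    have huu : u = u' := canRead_unique alg hf hpre hK hfK hu.of_append
      hu'.of_append.of_append
    subst huu
    exact ⟨u, (h3.symm.canRead h1 hu).of_append, (h4.symm.canRead h1'' hu').of_append⟩
  · obtain ⟨h1, -, h3⟩ := histEquiv_swap (K := [e']) (by simpa using Ne.symm hp) he he'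
    obtain ⟨u, hu⟩ := exists_canRead alg hlf h1
    exact ⟨u, hu.of_append, h3.canRead hee hu⟩

/-- From a bivalent history, any applicable step can be scheduled so that the resulting
history is bivalent. -/
theorem Bivalent.exists_extension (alg : SWSRAlg I p0 p1 v1) (hlf : OneResilientLockFree I)
    (hf : IsLinearizationFn I (SWSRSpec v0) f)
    (hpre : ∀ G H, G ∈ Histories I → H ∈ Histories I → G <+: H → f G <+: f H)
    (hbiv : Bivalent SWSROp.read H) {e : Step n I.Msg}
    (happ : Applicable I (applyHist I (initConfig I) H) e) :
    ∃ K, Bivalent SWSROp.read (H ++ K) ∧ e ∈ K := by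
  obtain ⟨hH, a, b, hab, ha, hb⟩ := hbiv
  have he : H ++ [e] ∈ Histories I := mem_histories_append_singleton.2 ⟨hH, happ⟩
  obtain ⟨u, hu⟩ := exists_canRead alg hlf he
  obtain ⟨v, huv, K, hK, hres⟩ : ∃ v, u ≠ v ∧ CanRead SWSROp.read H v := by
    by_cases h : u = a
    · exact ⟨b, by rwa [h], hb⟩
    · exact ⟨a, h, ha⟩
  clear ha hb happ
  induction K generalizing H with
  | nil =>
    refine ⟨[e], ⟨he, u, v, huv, hu, [], by simpa using he, ?_⟩, by simp⟩
    simp only [List.append_nil] at hres ⊢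
    exact mem_events_append_left hres
  | cons e' K ih =>
    have hK' : H ++ [e'] ++ K ∈ Histories I := by simpa using hK
    have hres' : Event.res SWSROp.read v ∈ events I (H ++ [e'] ++ K) := by simpa using hres
    have he' : H ++ [e'] ∈ Histories I := (mem_histories_append.1 hK').1
    by_cases hee : e = e'
    · subst hee
      exact ⟨[e], ⟨he, u, v, huv, hu, K, hK', hres'⟩, by simp⟩
    · obtain ⟨w, hw, hw'⟩ := exists_common_canRead alg hlf hf hpre he he' hee
      by_cases hwu : w = u
      · subst hwu
        have hee' : H ++ [e'] ++ [e] ∈ Histories I := by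
          obtain ⟨L, hL, -⟩ := hw'
          exact (mem_histories_append.1 hL).1
        obtain ⟨L, hL, heL⟩ := ih he' hee' hw' hK' hres'
        exact ⟨e' :: L, by simpa using hL, by simp [heL]⟩
      · exact ⟨[e], ⟨he, w, u, hwu, hw, hu⟩, by simp⟩

end Register

/-- **Corollary (SWSR registers).** For all `n ≥ 2`, there is no 1-resilient lock-free
strongly linearizable implementation of a single-writer single-reader register (over
any domain `V` with two distinct values `v0 ≠ v1`, with initial value `v0`) in an
asynchronous message-passing system of `n` processes. -/
theorem no_oneResilient_lockFree_stronglyLinearizable_SWSR (n : ℕ) (hn : 2 ≤ n)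
    (V : Type) (v0 v1 : V) (hv : v0 ≠ v1) :
    ¬ ∃ (I : Impl n (SWSROp V) V) (p0 p1 : Fin n),
        SWSRAlg I p0 p1 v1 ∧ OneResilientLockFree I ∧
        StronglyLinearizable I (SWSRSpec v0) := by
  rintro ⟨I, p0, p1, alg, hlf, f, hf, hpre⟩
  obtain ⟨H, hbiv, hp0⟩ := (bivalent_nil hv alg hlf hf hpre).exists_extension alg hlf hf hpre
    (applicable_none _ p0)
  rw [List.nil_append] at hbiv
  have hinv : Event.inv SWSROp.read ∈ events I H :=
    inv_mem_events_of_step alg.invokes_read ⟨_, hp0, rfl⟩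
  have hpend : Pending SWSROp.read (events I H) :=
    ⟨hinv, fun v h => hbiv.not_completed alg hf hpre _ ⟨hinv, v, h⟩⟩
  obtain ⟨S, hS, -, hcorr, hfair, hinf⟩ := exists_fair_run (I := I)
    (P := Bivalent SWSROp.read) (A := fun _ => True) (fun _ h => h.1) ⟨p0, trivial⟩
    (fun H hH e _ happ => by
      obtain ⟨K, h1, h2⟩ := hH.exists_extension alg hlf hf hpre happ
      exact ⟨K, h1, h2, fun _ _ => trivial⟩) H hbiv
  obtain ⟨k, o, hc, -⟩ := hlf H hbiv.1 p0 _ alg.proc_read hpend S hS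
    (fun p _ hp _ => absurd (hcorr p trivial) hp) (hcorr p0 trivial) hfair
  obtain ⟨k', hk', hbiv'⟩ := hinf k
  refine hbiv'.not_completed alg hf hpre o ?_
  obtain ⟨j, rfl⟩ := Nat.exists_eq_add_of_le hk'
  have hsplit : prefixSteps S (k + j) = prefixSteps S k ++ (List.range j).map (S <| k + ·) := by
    simp [prefixSteps, List.range_add]
  rw [hsplit, ← List.append_assoc]
  exact hc.append _

end MP
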